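/- Let X be a real 2n×2n matrix such that the matrix Y = -Xᵀ·J·X·J has no zero and no positive real eigenvalues (i.e. no real number t ≥ 0 lies in the spectrum of Y). Then there exists a real skew-symmetric matrix A (Aᵀ = -A) and a real symplectic matrix S (S·J·Sᵀ = J) such that X = S·D·A, where D is the block diagonal matrix D = [[Iₙ, 0], [0, -Iₙ]]. -/

import Mathlib

open Matrix

/-- The standard symplectic form matrix `J = [[0, -I_n], [I_n, 0]]`. -/
def symplJ (n : ℕ) : Matrix (Fin n ⊕ Fin n) (Fin n ⊕ Fin n) ℝ :=
  Matrix.fromBlocks 0 (-1) 1 0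

/-- The block diagonal matrix `D = [[I_n, 0], [0, -I_n]]`. -/
def Dmat (n : ℕ) : Matrix (Fin n ⊕ Fin n) (Fin n ⊕ Fin n) ℝ :=
  Matrix.fromBlocks 1 0 0 (-1)

open Polynomial in
/-- `X` is a square modulo any irreducible real polynomial without roots in `(-∞, 0]`. -/
theorem exists_dvd_sq_sub_X_of_irreducible {f : ℝ[X]} (hf : Irreducible f)
    (hroot : ∀ t : ℝ, t ≤ 0 → ¬ f.IsRoot t) : ∃ p : ℝ[X], f ∣ p ^ 2 - X := by
  by_cases h : ∃ t, f.IsRoot t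
  · obtain ⟨t, ht⟩ := h
    have htpos : 0 < t := by
      by_contra hle
      exact hroot t (not_lt.mp hle) ht
    have hassoc : Associated (X - C t) f :=
      (irreducible_X_sub_C t).associated_of_dvd hf (dvd_iff_isRoot.mpr ht)
    refine ⟨C √t, hassoc.symm.dvd.trans ⟨-1, ?_⟩⟩
    rw [← C_pow, Real.sq_sqrt htpos.le]
    ring
  · push Not at h
    have hdeg : f.natDegree = 2 := by
      have hle : f.natDegree ≤ 2 := hf.natDegree_le_two
      have hpos : 0 < f.natDegree := hf.natDegree_pos
      by_contra hne
      have hone : f.degree = 1 := by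
        rw [degree_eq_natDegree hf.ne_zero]
        have : f.natDegree = 1 := by omega
        simp [this]
      obtain ⟨t, ht⟩ := exists_root_of_degree_eq_one hone
      exact h t ht
    have ha : f.coeff 2 ≠ 0 := by
      rw [← hdeg]
      exact leadingCoeff_ne_zero.mpr hf.ne_zero
    have hfe : f = C (f.coeff 2) * X ^ 2 + C (f.coeff 1) * X + C (f.coeff 0) := by
      conv_lhs => rw [f.as_sum_range_C_mul_X_pow, hdeg]
      simp [Finset.sum_range_succ]
      ring
    generalize f.coeff 2 = a at *
    obtain ⟨b, hb⟩ : ∃ b, f.coeff 1 = a * b := ⟨f.coeff 1 / a, by field_simp⟩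
    obtain ⟨c, hc⟩ : ∃ c, f.coeff 0 = a * c := ⟨f.coeff 0 / a, by field_simp⟩
    rw [hb, hc] at hfe
    have hdisc : b ^ 2 < 4 * c := by
      by_contra! hle
      refine h ((-b + √(b ^ 2 - 4 * c)) / 2) ?_
      have hs := Real.sq_sqrt (sub_nonneg.mpr hle)
      rw [hfe]
      simp only [IsRoot.def, eval_add, eval_mul, eval_C, eval_pow, eval_X]
      linear_combination a / 4 * hs
    have hcpos : 0 < c := by nlinarith [sq_nonneg b]
    have hsc := Real.sq_sqrt hcpos.le
    have hk : 0 < 2 * √c - b := by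
      have := abs_lt_of_sq_lt_sq (a := b) (b := 2 * √c) (by rw [mul_pow, hsc]; linarith)
        (by positivity)
      linarith [(abs_lt.mp this).2]
    set k := 2 * √c - b with hkdef
    have hsk := Real.sq_sqrt hk.le
    refine ⟨C (√k)⁻¹ * (X + C √c), C (a⁻¹ * k⁻¹), ?_⟩
    have hb' : b = 2 * √c - k := by rw [hkdef]; ring
    have h1 : (C (√k)⁻¹ : ℝ[X]) ^ 2 = C k⁻¹ := by rw [← C_pow, inv_pow, hsk]
    have h2 : (C √c : ℝ[X]) ^ 2 = C c := by rw [← C_pow, hsc]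
    have h3 : (C k⁻¹ : ℝ[X]) * C k = 1 := by rw [← C_mul, inv_mul_cancel₀ hk.ne', C_1]
    have h4 : (C a⁻¹ : ℝ[X]) * C a = 1 := by rw [← C_mul, inv_mul_cancel₀ ha, C_1]
    rw [hfe, hb']
    simp only [C_mul, C_sub, C_ofNat]
    linear_combination (X + C √c) ^ 2 * h1 + C k⁻¹ * h2 + X * h3 -
      C k⁻¹ * (X ^ 2 + (2 * C √c - C k) * X + C c) * h4

open Polynomial in
/-- Hensel lifting of a square root of `X` from an irreducible modulus to its powers. -/
theorem exists_pow_dvd_sq_sub_X {K : Type*} [Field K] (h2 : (2 : K) ≠ 0) {f p₀ : K[X]}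
    (hf : Irreducible f) (h0 : ¬ f ∣ X) (hp₀ : f ∣ p₀ ^ 2 - X) (i : ℕ) :
    ∃ p : K[X], f ^ (i + 1) ∣ p ^ 2 - X := by
  induction i with
  | zero => exact ⟨p₀, by simpa using hp₀⟩
  | succ i ih =>
    obtain ⟨p, c, hc⟩ := ih
    have hfp : ¬ f ∣ p := fun h ↦ h0 <| by
      have hX : X = p * p - f * (f ^ i * c) := by linear_combination -hc
      rw [hX]
      exact dvd_sub (h.mul_right p) (dvd_mul_right _ _)
    obtain ⟨u, v, huv⟩ := hf.coprime_iff_not_dvd.mpr hfp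
    have hhalf : (2 : K[X]) * C 2⁻¹ = 1 := by
      rw [← C_ofNat, ← C_mul, mul_inv_cancel₀ h2, C_1]
    refine ⟨p - f ^ (i + 1) * (C 2⁻¹ * v * c), u * c + f ^ i * (C 2⁻¹ * v * c) ^ 2, ?_⟩
    linear_combination hc - f ^ (i + 1) * p * v * c * hhalf - f ^ (i + 1) * c * huv

open Polynomial in
/-- `X` is a square modulo any real polynomial without roots in `(-∞, 0]`. -/
theorem exists_dvd_sq_sub_X (q : ℝ[X]) (hroot : ∀ t : ℝ, t ≤ 0 → ¬ q.IsRoot t) :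
    ∃ p : ℝ[X], q ∣ p ^ 2 - X := by
  induction q using UniqueFactorizationMonoid.induction_on_coprime with
  | h0 => exact absurd (by simp) (hroot 0 le_rfl)
  | h1 hu => exact ⟨0, hu.dvd⟩
  | @hpr f i hf =>
    rcases i with _ | i
    · exact ⟨0, by simp⟩
    have hroot' : ∀ t : ℝ, t ≤ 0 → ¬ f.IsRoot t := fun t ht h ↦
      hroot t ht (h.dvd (dvd_pow_self f i.succ_ne_zero))
    obtain ⟨p, hp⟩ := exists_dvd_sq_sub_X_of_irreducible hf.irreducible hroot'
    refine exists_pow_dvd_sq_sub_X two_ne_zero hf.irreducible (fun h ↦ ?_) hp i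
    have hassoc : Associated f X := hf.irreducible.associated_of_dvd irreducible_X h
    exact hroot' 0 le_rfl ((show (X : ℝ[X]).IsRoot 0 by simp).dvd hassoc.symm.dvd)
  | @hcp f g hfg ihf ihg =>
    obtain ⟨p, c, hc⟩ := ihf fun t ht h ↦ hroot t ht (h.dvd (dvd_mul_right f g))
    obtain ⟨r, d, hd⟩ := ihg fun t ht h ↦ hroot t ht (h.dvd (dvd_mul_left g f))
    obtain ⟨u, v, huv⟩ : IsCoprime f g := hfg.isCoprime
    refine ⟨p + u * f * (r - p), IsCoprime.mul_dvd ⟨u, v, huv⟩ ?_ ?_⟩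
    · exact ⟨c + u * (r - p) * (2 * p + u * f * (r - p)), by linear_combination hc⟩
    · refine ⟨d - v * (r - p) * (2 * r - v * g * (r - p)), ?_⟩
      have huf : u * f = 1 - v * g := by linear_combination huv
      rw [huf]
      linear_combination hd

/-- A real square matrix without eigenvalues in `(-∞, 0]` has a square root which is a polynomial
in the matrix. -/
theorem Matrix.exists_aeval_sq_eq {m : Type*} [Fintype m] [DecidableEq m] (Z : Matrix m m ℝ)
    (hZ : ∀ t : ℝ, t ≤ 0 → t ∉ spectrum ℝ Z) :
    ∃ p : Polynomial ℝ, Polynomial.aeval Z p ^ 2 = Z := by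
  obtain ⟨p, c, hc⟩ := exists_dvd_sq_sub_X Z.charpoly fun t ht h ↦
    hZ t ht (Matrix.mem_spectrum_of_isRoot_charpoly h)
  refine ⟨p, ?_⟩
  have h := congrArg (Polynomial.aeval Z) hc
  rw [map_mul, Matrix.aeval_self_charpoly, zero_mul, map_sub, map_pow, Polynomial.aeval_X] at h
  exact sub_eq_zero.mp h

/-- Polynomials in a matrix inherit self-adjointness with respect to a bilinear form. -/
theorem Matrix.transpose_aeval_mul {m R : Type*} [Fintype m] [DecidableEq m] [CommRing R]
    {J Z : Matrix m m R} (hZ : Zᵀ * J = J * Z) (p : Polynomial R) :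
    (Polynomial.aeval Z p)ᵀ * J = J * Polynomial.aeval Z p := by
  induction p using Polynomial.induction_on with
  | C a => simp [Algebra.algebraMap_eq_smul_one]
  | add p q hp hq => simp [Matrix.add_mul, Matrix.mul_add, hp, hq]
  | monomial k a h =>
    have hsplit : Polynomial.aeval Z (Polynomial.C a * Polynomial.X ^ (k + 1)) =
        Polynomial.aeval Z (Polynomial.C a * Polynomial.X ^ k) * Z := by
      rw [pow_succ, ← mul_assoc, map_mul, Polynomial.aeval_X]
    have hcomm : Polynomial.aeval Z (Polynomial.C a * Polynomial.X ^ (k + 1)) =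
        Z * Polynomial.aeval Z (Polynomial.C a * Polynomial.X ^ k) := by
      rw [pow_succ', mul_left_comm, map_mul, Polynomial.aeval_X]
    rw [hcomm, Matrix.transpose_mul, Matrix.mul_assoc, hZ, ← Matrix.mul_assoc, h,
      Matrix.mul_assoc, ← hsplit, hcomm]

theorem symplJ_transpose (n : ℕ) : (symplJ n)ᵀ = -symplJ n := by
  simp [symplJ, Matrix.fromBlocks_transpose, Matrix.fromBlocks_neg]

theorem symplJ_mul_self (n : ℕ) : symplJ n * symplJ n = -1 := by
  rw [← Matrix.fromBlocks_one, Matrix.fromBlocks_neg]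
  simp [symplJ, Matrix.fromBlocks_multiply]

theorem Dmat_transpose (n : ℕ) : (Dmat n)ᵀ = Dmat n := by
  simp [Dmat, Matrix.fromBlocks_transpose]

theorem Dmat_mul_self (n : ℕ) : Dmat n * Dmat n = 1 := by
  simp [Dmat, Matrix.fromBlocks_multiply]

theorem Dmat_mul_symplJ_mul_Dmat (n : ℕ) : Dmat n * symplJ n * Dmat n = -symplJ n := by
  simp [Dmat, symplJ, Matrix.fromBlocks_multiply, Matrix.fromBlocks_neg]

/-- Corollary: if `Y = -X^T*J*X*J` has no real eigenvalue `t ≥ 0`, then `X = S * D * A` with `A` skew-symmetric and `S` symplectic. -/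
theorem stmt_12 (n : ℕ) (X : Matrix (Fin n ⊕ Fin n) (Fin n ⊕ Fin n) ℝ)
    (hY : ∀ t : ℝ, t ≥ 0 → t ∉ spectrum ℝ (-(Xᵀ * symplJ n * X * symplJ n))) :
    ∃ A S : Matrix (Fin n ⊕ Fin n) (Fin n ⊕ Fin n) ℝ,
      Aᵀ = -A ∧ S * symplJ n * Sᵀ = symplJ n ∧ X = S * Dmat n * A := by
  have hJT := symplJ_transpose n
  have hJJ := symplJ_mul_self n
  have hDT := Dmat_transpose n
  have hDD := Dmat_mul_self n
  have hDJD := Dmat_mul_symplJ_mul_Dmat n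
  set J := symplJ n
  set D := Dmat n
  set Z := Xᵀ * J * X * J with hZdef
  have hZspec : ∀ t : ℝ, t ≤ 0 → t ∉ spectrum ℝ Z := fun t ht h ↦ by
    refine hY (-t) (by linarith) ?_
    rw [← spectrum.neg_eq]
    simpa using h
  have hZJ : Zᵀ * J = J * Z := by
    simp only [hZdef, Matrix.transpose_mul, Matrix.transpose_transpose, hJT]
    noncomm_ring
  obtain ⟨p, hp⟩ := Matrix.exists_aeval_sq_eq Z hZspec
  have hHJ := Matrix.transpose_aeval_mul hZJ p
  set H := Polynomial.aeval Z p
  have hHunit : IsUnit H := by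
    have hZunit : IsUnit Z := spectrum.zero_notMem_iff ℝ |>.mp (hZspec 0 le_rfl)
    rw [← hp] at hZunit
    exact (isUnit_pow_iff two_ne_zero).mp hZunit
  have hJunit : IsUnit J := IsUnit.of_mul_eq_one (-J) (by rw [mul_neg, hJJ, neg_neg])
  have hDunit : IsUnit D := IsUnit.of_mul_eq_one D hDD
  set A := -(H * J) with hA
  have hAT : Aᵀ = -A := by
    have hHT : Hᵀ = -(J * H * J) := by
      rw [← hHJ, mul_assoc, hJJ, mul_neg, mul_one, neg_neg]
    rw [hA, Matrix.transpose_neg, Matrix.transpose_mul, hHT, hJT, neg_mul_neg, mul_assoc J H J,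
      ← mul_assoc J J, hJJ, neg_one_mul]
  have hAJA : A * J * A = Xᵀ * J * X := by
    calc A * J * A = H * (J * J) * (H * J) := by rw [hA]; noncomm_ring
      _ = -(H ^ 2 * J) := by rw [hJJ]; noncomm_ring
      _ = -(Xᵀ * J * X * (J * J)) := by rw [hp, hZdef]; noncomm_ring
      _ = Xᵀ * J * X := by rw [hJJ]; noncomm_ring
  obtain ⟨B, hB⟩ : IsUnit (D * A) := hDunit.mul (hHunit.mul hJunit).neg
  set C : Matrix (Fin n ⊕ Fin n) (Fin n ⊕ Fin n) ℝ := ↑B⁻¹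
  have hBC : D * A * C = 1 := by rw [← hB]; exact B.mul_inv
  have hCB : C * (D * A) = 1 := by rw [← hB]; exact B.inv_mul
  have hSJS : (X * C)ᵀ * J * (X * C) = J := by
    calc (X * C)ᵀ * J * (X * C) = Cᵀ * (Xᵀ * J * X) * C := by
          rw [Matrix.transpose_mul]; noncomm_ring
      _ = Cᵀ * (Aᵀ * (D * J * D) * A) * C := by rw [← hAJA, hDJD, hAT]; noncomm_ring
      _ = (D * A * C)ᵀ * J * (D * A * C) := by
          simp only [Matrix.transpose_mul, hDT]; noncomm_ring
      _ = J := by rw [hBC]; simp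
  refine ⟨A, X * C, hAT, ?_, ?_⟩
  · have hinv : (-(J * (X * C)ᵀ * J)) * (X * C) = 1 := by
      calc (-(J * (X * C)ᵀ * J)) * (X * C) = -(J * ((X * C)ᵀ * J * (X * C))) := by noncomm_ring
        _ = 1 := by rw [hSJS, hJJ, neg_neg]
    have hinv' := mul_eq_one_comm.mp hinv
    calc X * C * J * (X * C)ᵀ = X * C * J * (X * C)ᵀ * (-(J * J)) := by
          rw [hJJ, neg_neg, mul_one]
      _ = (X * C) * (-(J * (X * C)ᵀ * J)) * J := by noncomm_ring
      _ = J := by rw [hinv', one_mul]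
  · rw [mul_assoc, mul_assoc, hCB, mul_one]
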